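/- Let G = (V,E) be a finite connected simple graph in which every vertex has degree 2 or 3 (so G is a coregraph of maximum degree 3), and let n = |E| - |V| + 1. Then for every l with 0 ≤ l ≤ n-1, the number of subsets s ⊆ E such that the spanning subgraph (V,s) has no vertex of degree 1 and has exactly 2l vertices of degree 3 equals C_{n,l}, where C_{n,0} = 2^n and C_{n,l} = Σ_{k=l+1}^{n} C(n,k)·C(k+l-1, 2l) for 1 ≤ l ≤ n-1. -/

import Mathlib

/-- The degree of vertex `i` in the spanning subgraph `(V, s)`. -/
def degIn {V : Type*} [DecidableEq V] (s : Finset (Sym2 V)) (i : V) : ℕ :=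
  (s.filter (fun e => i ∈ e)).card

/-- The coefficients `C_{n,0} = 2^n` and
`C_{n,l} = Σ_{k=l+1}^{n} C(n,k)·C(k+l-1, 2l)` for `l ≥ 1`. -/
def Cnl (n l : ℕ) : ℤ :=
  if l = 0 then 2 ^ n
  else ∑ k ∈ Finset.Icc (l + 1) n, (n.choose k : ℤ) * ((k + l - 1).choose (2 * l) : ℤ)

/-- Exchanging the product over edges with the product over vertices. -/
theorem prod_pow_degIn {V R : Type*} [Fintype V] [DecidableEq V] [CommMonoid R]
    (s : Finset (Sym2 V)) (x : V → R) :
    ∏ i, x i ^ degIn s i = ∏ e ∈ s, ∏ i with i ∈ e, x i := by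
  simp only [degIn, ← Finset.prod_const, Finset.prod_filter]
  rw [Finset.prod_comm]

/-- A vertex-weighted sum over edge subsets, when the vertex weight is a sum of two geometric
sequences, is a sum over two-colourings of the vertices. -/
theorem sum_powerset_prod_degIn {V R : Type*} [Fintype V] [DecidableEq V] [CommRing R]
    (E : Finset (Sym2 V)) (a x : Bool → R) :
    ∑ s ∈ E.powerset, ∏ i, ∑ c, a c * x c ^ degIn s i
      = ∑ σ : V → Bool, (∏ i, a (σ i)) * ∏ e ∈ E, (1 + ∏ i with i ∈ e, x (σ i)) := by
  simp_rw [Finset.prod_one_add, Finset.mul_sum, Finset.prod_univ_sum, Fintype.piFinset_univ,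
    Finset.prod_mul_distrib]
  rw [Finset.sum_comm]
  refine Finset.sum_congr rfl fun σ _ => Finset.sum_congr rfl fun s _ => ?_
  rw [prod_pow_degIn s fun i => x (σ i)]

theorem prod_filter_mem_sym2 {V R : Type*} [Fintype V] [DecidableEq V] [CommMonoid R]
    {u v : V} (h : u ≠ v) (x : V → R) :
    ∏ i with i ∈ s(u, v), x i = x u * x v := by
  rw [← Finset.prod_pair h]
  congr 1
  ext i
  simp

theorem SimpleGraph.Connected.exists_adj_ne {V α : Type*} {G : SimpleGraph V}
    (hG : G.Connected) {f : V → α} {u v : V} (h : f u ≠ f v) :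
    ∃ a b, G.Adj a b ∧ f a ≠ f b := by
  by_contra! hc
  obtain ⟨p⟩ := hG.preconnected u v
  apply h
  induction p with
  | nil => rfl
  | cons hadj _ ih =>
    rw [hc _ _ hadj]
    by_contra hne
    exact hne (ih hne)

/-- If `x true * x false = -1`, only the two constant colourings of a connected graph
contribute. -/
theorem SimpleGraph.Connected.sum_coloring {V K : Type*} [Fintype V] [DecidableEq V] [Field K]
    {G : SimpleGraph V} [DecidableRel G.Adj] (hG : G.Connected) (a x : Bool → K)
    (hx : x true * x false = -1) :
    ∑ σ : V → Bool, (∏ i, a (σ i)) * ∏ e ∈ G.edgeFinset, (1 + ∏ i with i ∈ e, x (σ i))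
      = ∑ c, a c ^ Fintype.card V * (1 + x c ^ 2) ^ G.edgeFinset.card := by
  have hne : Nonempty V := hG.nonempty
  obtain ⟨v₀⟩ := hne
  have hconst (c : Bool) : (∏ _i : V, a c) * ∏ e ∈ G.edgeFinset, (1 + ∏ i with i ∈ e, x c)
      = a c ^ Fintype.card V * (1 + x c ^ 2) ^ G.edgeFinset.card := by
    congr 1
    · simp
    · rw [← Finset.prod_const]
      refine Finset.prod_congr rfl fun e he => ?_
      induction e using Sym2.ind with
      | _ u v =>
        have huv : G.Adj u v := by simpa using he
        rw [prod_filter_mem_sym2 huv.ne fun _ => x c, sq]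
  simp_rw [← hconst]
  symm
  refine Finset.sum_of_injOn (fun c _ => c) (fun c _ d _ h => congrFun h v₀) (by simp) ?_
    (fun _ _ => rfl)
  intro σ _ hσ
  have hσ' : ∃ v, σ v ≠ σ v₀ := by
    by_contra! h
    exact hσ ⟨σ v₀, by simp, funext fun v => (h v).symm⟩
  obtain ⟨v, hv⟩ := hσ'
  obtain ⟨u, w, huw, hne⟩ := hG.exists_adj_ne hv
  refine mul_eq_zero_of_right _ (Finset.prod_eq_zero (i := s(u, w)) (by simpa using huw) ?_)
  rw [prod_filter_mem_sym2 huw.ne fun i => x (σ i)]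
  have hx' : x false * x true = -1 := by rw [mul_comm, hx]
  cases hu : σ u <;> cases hw : σ w <;> simp_all

/-- The even and odd binomial sums `∑ C(k+l, 2l) g^(2l)` and `∑ C(k+l+1, 2l+1) g^(2l+1)` are
values of any sequence with the recurrence `f (m + 2) = g * f (m + 1) + f m` and
initial values `1`, `0`. -/
theorem sum_choose_eq_of_recurrence {R : Type*} [CommRing R] (g : R) (f : ℕ → R) (h0 : f 0 = 1)
    (h1 : f 1 = 0) (hf : ∀ m, f (m + 2) = g * f (m + 1) + f m) (N k : ℕ) (hk : k ≤ N) :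
    ∑ l ∈ Finset.range (N + 1), ((k + l).choose (2 * l) : R) * g ^ (2 * l) = f (2 * k + 2) ∧
    ∑ l ∈ Finset.range (N + 1), ((k + l + 1).choose (2 * l + 1) : R) * g ^ (2 * l + 1)
      = f (2 * k + 3) := by
  induction k with
  | zero =>
    have h2 : f 2 = 1 := by rw [hf 0, h1, h0]; ring
    have h3 : f 3 = g := by rw [hf 1, h2, h1]; ring
    constructor
    · rw [Finset.sum_range_succ', Finset.sum_eq_zero]
      · simp [h2]
      · intro l _
        rw [Nat.choose_eq_zero_of_lt (by omega)]; simp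
    · rw [Finset.sum_range_succ', Finset.sum_eq_zero]
      · simp [h3]
      · intro l _
        rw [Nat.choose_eq_zero_of_lt (by omega)]; simp
  | succ k ih =>
    obtain ⟨ihS, ihT⟩ := ih (by omega)
    have hS : ∑ l ∈ Finset.range (N + 1), ((k + 1 + l).choose (2 * l) : R) * g ^ (2 * l)
        = f (2 * (k + 1) + 2) := by
      rw [show 2 * (k + 1) + 2 = 2 * k + 2 + 2 by ring, hf, ← ihS,
        show 2 * k + 2 + 1 = 2 * k + 3 by ring, ← ihT, Finset.sum_range_succ',
        Finset.sum_range_succ' (fun l => ((k + l).choose (2 * l) : R) * g ^ (2 * l)),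
        Finset.sum_range_succ, Nat.choose_eq_zero_of_lt (show k + N + 1 < 2 * N + 1 by omega)]
      have hstep : ∀ l : ℕ, ((k + 1 + (l + 1)).choose (2 * (l + 1)) : R) * g ^ (2 * (l + 1))
          = g * (((k + l + 1).choose (2 * l + 1) : R) * g ^ (2 * l + 1))
            + ((k + (l + 1)).choose (2 * (l + 1)) : R) * g ^ (2 * (l + 1)) := by
        intro l
        rw [show k + 1 + (l + 1) = k + l + 1 + 1 by ring,
          show 2 * (l + 1) = 2 * l + 1 + 1 by ring, Nat.choose_succ_succ,
          show k + (l + 1) = k + l + 1 by ring]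
        push_cast
        ring
      simp_rw [hstep, Finset.sum_add_distrib, ← Finset.mul_sum]
      simp
      ring
    refine ⟨hS, ?_⟩
    rw [show 2 * (k + 1) + 3 = 2 * k + 3 + 2 by ring, hf, ← ihT,
      show 2 * k + 3 + 1 = 2 * (k + 1) + 2 by ring, ← hS, Finset.mul_sum,
      ← Finset.sum_add_distrib]
    refine Finset.sum_congr rfl fun l _ => ?_
    rw [Nat.choose_succ_succ, show k + 1 + l = k + l + 1 by ring]
    push_cast
    ring

theorem Cnl_eq_sum_range (n l : ℕ) :
    Cnl n l = ∑ k ∈ Finset.range (n + 1),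
      (n.choose k : ℤ) * ((k + l - 1).choose (2 * l) : ℤ) := by
  unfold Cnl
  split_ifs with h
  · subst h
    simp only [mul_zero, Nat.choose_zero_right, Nat.cast_one, mul_one]
    exact_mod_cast (Nat.sum_range_choose n).symm
  · refine Finset.sum_subset (fun k hk => ?_) fun k hk hk' => ?_
    · simp only [Finset.mem_Icc, Finset.mem_range] at *
      omega
    · simp only [Finset.mem_Icc, Finset.mem_range] at *
      rw [Nat.choose_eq_zero_of_lt (show k + l - 1 < 2 * l by omega)]
      simp

theorem sum_Cnl_mul_pow {R : Type*} [CommRing R] (g : R) (f : ℕ → R) (h0 : f 0 = 1)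
    (h1 : f 1 = 0) (hf : ∀ m, f (m + 2) = g * f (m + 1) + f m) (n : ℕ) (hn : 0 < n) :
    ∑ l ∈ Finset.range n, (Cnl n l : R) * g ^ (2 * l)
      = ∑ k ∈ Finset.range (n + 1), (n.choose k : R) * f (2 * k) := by
  obtain ⟨N, rfl⟩ : ∃ N, n = N + 1 := ⟨n - 1, by omega⟩
  simp_rw [Cnl_eq_sum_range]
  push_cast
  simp_rw [Finset.sum_mul, mul_assoc]
  rw [Finset.sum_comm]
  refine Finset.sum_congr rfl fun k hk => ?_
  rw [← Finset.mul_sum]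
  congr 1
  rcases k with _ | k
  · rw [Finset.sum_range_succ', Finset.sum_eq_zero]
    · simp [h0]
    · intro l _
      rw [Nat.choose_eq_zero_of_lt (by omega)]; simp
  · rw [Finset.mem_range] at hk
    rw [mul_add, ← (sum_choose_eq_of_recurrence g f h0 h1 hf N k (by omega)).1]
    refine Finset.sum_congr rfl fun l _ => ?_
    rw [show k + 1 + l - 1 = k + l by omega]

theorem degIn_le_degree {V : Type*} [Fintype V] [DecidableEq V] (G : SimpleGraph V)
    [DecidableRel G.Adj] {s : Finset (Sym2 V)} (hs : s ⊆ G.edgeFinset) (i : V) :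
    degIn s i ≤ G.degree i := by
  rw [← G.card_incidenceFinset_eq_degree, degIn]
  refine Finset.card_le_card fun e he => ?_
  rw [Finset.mem_filter] at he
  rw [SimpleGraph.mem_incidenceFinset]
  exact ⟨SimpleGraph.mem_edgeFinset.1 (hs he.1), he.2⟩

/-- The generating function of edge subsets without vertices of degree one, by number of
vertices of degree three, as a vertex-weighted sum. -/
theorem prod_weight_degIn {V R : Type*} [Fintype V] [DecidableEq V] [CommRing R]
    (s : Finset (Sym2 V)) (hs : ∀ i, degIn s i ≤ 3) (g : R) (f : ℕ → R) (h0 : f 0 = 1)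
    (h1 : f 1 = 0) (h2 : f 2 = 1) (h3 : f 3 = g) :
    ∏ i, f (degIn s i) = if ∀ i, degIn s i ≠ 1 then
      g ^ (Finset.univ.filter fun i => degIn s i = 3).card else 0 := by
  split_ifs with h
  · rw [← Finset.prod_const, Finset.prod_filter]
    refine Finset.prod_congr rfl fun i _ => ?_
    have := hs i
    have := h i
    generalize degIn s i = d at *
    interval_cases d <;> simp_all
  · push Not at h
    obtain ⟨i, hi⟩ := h
    exact Finset.prod_eq_zero (Finset.mem_univ i) (by rw [hi, h1])

/-- The generating function of the numbers of sub-coregraphs. -/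
theorem sum_sub_coregraphs_eval {V : Type*} [Fintype V] [DecidableEq V]
    (G : SimpleGraph V) [DecidableRel G.Adj] (hconn : G.Connected)
    (hdeg : ∀ v : V, G.degree v ≤ 3)
    (n : ℕ) (hn : n + Fintype.card V = G.edgeFinset.card + 1) (hpos : 0 < n) (g : ℝ) :
    ∑ s ∈ G.edgeFinset.powerset.filter (fun s => ∀ i : V, degIn s i ≠ 1),
        g ^ (Finset.univ.filter fun i : V => degIn s i = 3).card
      = ∑ l ∈ Finset.range n, (Cnl n l : ℝ) * g ^ (2 * l) := by
  obtain ⟨x, hx, hxy⟩ : ∃ x : Bool → ℝ, (∀ c, x c ^ 2 = g * x c + 1) ∧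
      x true * x false = -1 := by
    have hsq : √(g ^ 2 + 4) ^ 2 = g ^ 2 + 4 := Real.sq_sqrt (by positivity)
    refine ⟨fun c => if c then (g + √(g ^ 2 + 4)) / 2 else (g - √(g ^ 2 + 4)) / 2, ?_, ?_⟩
    · intro c
      cases c <;> simp <;> linarith
    · simp
      linarith
  have hpos' (c : Bool) : 1 + x c ^ 2 ≠ 0 := by positivity
  set f : ℕ → ℝ := fun m => ∑ c, (1 + x c ^ 2)⁻¹ * x c ^ m with hfdef
  have hf (m : ℕ) : f (m + 2) = g * f (m + 1) + f m := by
    simp only [hfdef, Finset.mul_sum, ← Finset.sum_add_distrib]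
    refine Finset.sum_congr rfl fun c _ => ?_
    rw [pow_add _ m 2, hx c]
    ring
  have h0 : f 0 = 1 := by
    have ht := hpos' true
    have hfa := hpos' false
    simp only [hfdef, Fintype.sum_bool]
    field_simp
    linear_combination (1 - x true * x false) * hxy
  have h1 : f 1 = 0 := by
    have ht := hpos' true
    have hfa := hpos' false
    simp only [hfdef, Fintype.sum_bool]
    field_simp
    linear_combination (x true + x false) * hxy
  have h2 : f 2 = 1 := by rw [hf 0, h1, h0]; ring
  have h3 : f 3 = g := by rw [hf 1, h2, h1]; ring
  rw [sum_Cnl_mul_pow g f h0 h1 hf n hpos, Finset.sum_filter]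
  have hcol : ∑ s ∈ G.edgeFinset.powerset, ∏ i, f (degIn s i)
      = ∑ c, (1 + x c ^ 2)⁻¹ ^ Fintype.card V * (1 + x c ^ 2) ^ G.edgeFinset.card := by
    rw [← hconn.sum_coloring (fun c => (1 + x c ^ 2)⁻¹) x hxy]
    exact sum_powerset_prod_degIn G.edgeFinset (fun c => (1 + x c ^ 2)⁻¹) x
  have hlhs : ∑ s ∈ G.edgeFinset.powerset, (if ∀ i, degIn s i ≠ 1 then
      g ^ (Finset.univ.filter fun i => degIn s i = 3).card else 0)
      = ∑ s ∈ G.edgeFinset.powerset, ∏ i, f (degIn s i) :=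
    Finset.sum_congr rfl fun s hs => (prod_weight_degIn s (fun i =>
      (degIn_le_degree G (Finset.mem_powerset.1 hs) i).trans (hdeg i)) g f h0 h1 h2 h3).symm
  rw [hlhs, hcol]
  simp only [hfdef, Finset.mul_sum]
  rw [Finset.sum_comm]
  refine Finset.sum_congr rfl fun c _ => ?_
  have hbin : ∑ k ∈ Finset.range (n + 1), (n.choose k : ℝ) * ((1 + x c ^ 2)⁻¹ * x c ^ (2 * k))
      = (1 + x c ^ 2)⁻¹ * (1 + x c ^ 2) ^ n := by
    rw [add_comm 1 (x c ^ 2), add_pow, Finset.mul_sum]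
    refine Finset.sum_congr rfl fun k _ => ?_
    rw [one_pow, pow_mul]
    ring
  have hc := hpos' c
  rw [hbin, inv_pow]
  field_simp
  rw [← pow_add, ← pow_succ', ← hn, add_comm n]

theorem count_sub_coregraphs_cubic {V : Type*} [Fintype V] [DecidableEq V]
    (G : SimpleGraph V) [DecidableRel G.Adj] (hconn : G.Connected)
    (hdeg : ∀ v : V, G.degree v = 2 ∨ G.degree v = 3)
    (n : ℕ) (hn : n + Fintype.card V = G.edgeFinset.card + 1)
    (l : ℕ) (hl : l < n) :
    ((G.edgeFinset.powerset.filter (fun s =>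
        (∀ i : V, degIn s i ≠ 1) ∧
          (Finset.univ.filter (fun i : V => degIn s i = 3)).card = 2 * l)).card : ℤ)
      = Cnl n l := by
  have hpoly : ∑ s ∈ G.edgeFinset.powerset.filter (fun s => ∀ i : V, degIn s i ≠ 1),
        (Polynomial.X : Polynomial ℝ) ^ (Finset.univ.filter fun i : V => degIn s i = 3).card
      = ∑ l ∈ Finset.range n, Polynomial.C (Cnl n l : ℝ) * Polynomial.X ^ (2 * l) := by
    refine Polynomial.funext fun g => ?_
    simpa [Polynomial.eval_finsetSum] using sum_sub_coregraphs_eval G hconn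
      (fun v => by have := hdeg v; omega) n hn (by omega) g
  have hcoeff := congrArg (fun p => p.coeff (2 * l)) hpoly
  simp only [Polynomial.finsetSum_coeff, Polynomial.coeff_X_pow, Polynomial.coeff_C_mul] at hcoeff
  rw [Finset.sum_boole, Finset.filter_filter, Finset.sum_eq_single l
    (fun k _ hk => by simp [hk.symm]) (fun h => absurd (Finset.mem_range.2 hl) h)] at hcoeff
  simp only [if_true, mul_one, eq_comm (a := 2 * l)] at hcoeff
  exact_mod_cast hcoeff
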